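/- Let F : P → P' be a (lax) monoidal functor between Picard categories. If F induces a bijection π₀(P) → π₀(P') on isomorphism classes of objects and an isomorphism π₁(P) → π₁(P') on the automorphism groups of the unit objects, then F is an equivalence of categories. -/

import Mathlib

/-!
STATEMENT 0: Let `F : P → P'` be a (lax) monoidal functor between Picard categories.
If `F` induces a bijection `π₀(P) → π₀(P')` on isomorphism classes of objects and an
isomorphism `π₁(P) → π₁(P')` on the automorphism groups of the unit objects, then `F`
is an equivalence of categories.
-/

open CategoryTheory MonoidalCategory

universe v u v' u'

/-- A Picard category: a monoidal category which is a groupoid (every morphism is an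
isomorphism) and whose translation functors `X ⊗ –` and `– ⊗ X` are equivalences. -/
class PicardCat (P : Type u) [Category.{v} P] [MonoidalCategory P] : Prop where
  isIso : ∀ {X Y : P} (f : X ⟶ Y), IsIso f
  tensorLeft_isEquivalence : ∀ X : P, (tensorLeft X).IsEquivalence
  tensorRight_isEquivalence : ∀ X : P, (tensorRight X).IsEquivalence

/-- `π₀` of a category: the isomorphism classes of objects. -/
def pi0 (P : Type u) [Category.{v} P] : Type u := Quotient (isIsomorphicSetoid P)

/-- The map induced on isomorphism classes by a functor. -/
def pi0Map {P : Type u} [Category.{v} P] {P' : Type u'} [Category.{v'} P']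
    (F : P ⥤ P') : pi0 P → pi0 P' :=
  Quotient.map F.obj (fun _ _ h => h.elim fun e => ⟨F.mapIso e⟩)

/-- The map induced on `π₁`, i.e. on automorphism groups of the unit objects, by a lax
monoidal functor to a Picard category; it is obtained by conjugating the image of an
automorphism of the unit by the (invertible) unit structure morphism `ε`. -/
noncomputable def pi1Map {P : Type u} [Category.{v} P] [MonoidalCategory P]
    {P' : Type u'} [Category.{v'} P'] [MonoidalCategory P'] [PicardCat P']
    (F : P ⥤ P') [F.LaxMonoidal] : Aut (𝟙_ P) → Aut (𝟙_ P') := fun f =>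
  haveI : IsIso (Functor.LaxMonoidal.ε F) := PicardCat.isIso _
  asIso (Functor.LaxMonoidal.ε F) ≪≫ F.mapIso f ≪≫ (asIso (Functor.LaxMonoidal.ε F)).symm

open Functor.LaxMonoidal in
/-- Conjugation by the left unitor intertwines the action of a lax monoidal functor on
automorphisms of the unit with its action on endomorphisms of `X`. -/
theorem leftUnitor_hom_map_conj {P : Type u} [Category.{v} P] [MonoidalCategory P]
    {P' : Type u'} [Category.{v'} P'] [MonoidalCategory P'] [PicardCat P']
    (F : P ⥤ P') [F.LaxMonoidal] (f : Aut (𝟙_ P)) (X : P) :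
    (λ_ (F.obj X)).hom ≫ F.map ((λ_ X).inv ≫ f.hom ▷ X ≫ (λ_ X).hom) =
      (pi1Map F f).hom ▷ F.obj X ≫ (λ_ (F.obj X)).hom := by
  have : IsIso (ε F) := PicardCat.isIso _
  have h : (pi1Map F f).hom ≫ ε F = ε F ≫ F.map f.hom := by
    simp only [pi1Map, Iso.trans_hom, Iso.symm_hom, Category.assoc, asIso_inv, asIso_hom,
      IsIso.inv_hom_id, Category.comp_id]
    rfl
  rw [left_unitality, ← comp_whiskerRight_assoc, h]
  simp [← Functor.map_comp]

theorem exists_aut_unit_of_hom {P : Type u} [Category.{v} P] [MonoidalCategory P]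
    [PicardCat P] {X : P} (g : X ⟶ X) :
    ∃ f : Aut (𝟙_ P), f.hom ▷ X = (λ_ X).hom ≫ g ≫ (λ_ X).inv := by
  have := PicardCat.tensorRight_isEquivalence X
  obtain ⟨f, hf⟩ := (tensorRight X).map_surjective ((λ_ X).hom ≫ g ≫ (λ_ X).inv)
  have : IsIso f := PicardCat.isIso f
  exact ⟨asIso f, hf⟩

theorem map_bijective_of_pi1Map_bijective {P : Type u} [Category.{v} P] [MonoidalCategory P]
    {P' : Type u'} [Category.{v'} P'] [MonoidalCategory P']
    [PicardCat P] [PicardCat P'] (F : P ⥤ P') [F.LaxMonoidal]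
    (h1 : Function.Bijective (pi1Map F)) (X : P) :
    Function.Bijective (F.map : (X ⟶ X) → (F.obj X ⟶ F.obj X)) := by
  constructor
  · intro g₁ g₂ h
    obtain ⟨f₁, hf₁⟩ := exists_aut_unit_of_hom g₁
    obtain ⟨f₂, hf₂⟩ := exists_aut_unit_of_hom g₂
    have e₁ := leftUnitor_hom_map_conj F f₁ X
    have e₂ := leftUnitor_hom_map_conj F f₂ X
    simp only [hf₁, hf₂, Category.assoc, Iso.inv_hom_id, Iso.inv_hom_id_assoc,
      Category.comp_id] at e₁ e₂
    rw [h, e₂, cancel_mono] at e₁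
    have := PicardCat.tensorRight_isEquivalence (F.obj X)
    have e : f₂ = f₁ := h1.injective (Iso.ext ((tensorRight (F.obj X)).map_injective e₁))
    subst e
    simpa using hf₁.symm.trans hf₂
  · intro g
    obtain ⟨f', hf'⟩ := exists_aut_unit_of_hom g
    obtain ⟨f, rfl⟩ := h1.surjective f'
    refine ⟨(λ_ X).inv ≫ f.hom ▷ X ≫ (λ_ X).hom, ?_⟩
    rw [← cancel_epi (λ_ (F.obj X)).hom, leftUnitor_hom_map_conj, hf']
    simp

theorem statement0 {P : Type u} [Category.{v} P] [MonoidalCategory P]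
    {P' : Type u'} [Category.{v'} P'] [MonoidalCategory P']
    [PicardCat P] [PicardCat P']
    (F : P ⥤ P') [F.LaxMonoidal]
    (h0 : Function.Bijective (pi0Map F))
    (h1 : Function.Bijective (pi1Map F)) :
    F.IsEquivalence := by
  have hb := map_bijective_of_pi1Map_bijective F h1
  have : F.Faithful := ⟨fun {X Y f g} h => by
    have : IsIso g := PicardCat.isIso g
    have e : f ≫ inv g = 𝟙 X := (hb X).injective (by simp [h])
    simpa using e =≫ g⟩
  have : F.Full := ⟨fun {X Y} g => by
    have : IsIso g := PicardCat.isIso g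
    obtain ⟨e⟩ : Nonempty (X ≅ Y) := Quotient.exact (h0.injective
      (Quotient.sound ⟨asIso g⟩ : pi0Map F (Quotient.mk _ X) = pi0Map F (Quotient.mk _ Y)))
    obtain ⟨k, hk⟩ := (hb X).surjective (g ≫ F.map e.inv)
    exact ⟨k ≫ e.hom, by
      rw [F.map_comp, hk, Category.assoc, ← F.map_comp, e.inv_hom_id, F.map_id, Category.comp_id]⟩⟩
  have : F.EssSurj := ⟨fun Y => by
    obtain ⟨x, hx⟩ := h0.surjective (Quotient.mk _ Y)
    induction x using Quotient.inductionOn with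
    | h X => exact ⟨X, Quotient.exact hx⟩⟩
  exact {}
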